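/- Let 𝔄 be a unital C*-algebra and let H : ℝ → 𝔄 be continuous with H(s)* = H(s) for all s ∈ [0, T]. For 0 ≤ t ≤ T let U(t) = 1 + ∑_{n=1}^∞ (−i)ⁿ • ∫_{Δₙ(t)} H(s (n−1)) * ⋯ * H(s 0) ds be the time-ordered exponential series. Then U(t) is unitary for every t ∈ [0, T]: U(t)* * U(t) = 1 and U(t) * U(t)* = 1. -/

import Mathlib

open MeasureTheory

/-- The open simplex `Δₙ(t) = {s | 0 < s 0 < s 1 < ⋯ < s (n-1) < t}` in `Fin n → ℝ`. -/
def openSimplex (n : ℕ) (t : ℝ) : Set (Fin n → ℝ) :=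
  {s : Fin n → ℝ | (∀ i j : Fin n, i < j → s i < s j) ∧ ∀ i : Fin n, 0 < s i ∧ s i < t}

/-- The chronologically (decreasing time) ordered product
`H(s (n-1)) * H(s (n-2)) * ⋯ * H(s 0)`, later times to the left. -/
def chronoProd {𝔄 : Type*} [Monoid 𝔄] (H : ℝ → 𝔄) (n : ℕ) (s : Fin n → ℝ) : 𝔄 :=
  ((List.ofFn fun i : Fin n => H (s i)).reverse).prod

/-- The time-ordered exponential
`U(t) = 1 + ∑_{n≥1} (−i)ⁿ • ∫_{Δₙ(t)} H(s (n-1)) ⋯ H(s 0) ds`. -/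
noncomputable def chronoExp {𝔄 : Type*} [NormedRing 𝔄] [NormedAlgebra ℂ 𝔄]
    [CompleteSpace 𝔄] (H : ℝ → 𝔄) (t : ℝ) : 𝔄 :=
  1 + ∑' n : ℕ, ((-Complex.I) ^ (n + 1)) •
    ∫ s in openSimplex (n + 1) t, chronoProd H (n + 1) s
      ∂(Measure.pi fun _ : Fin (n + 1) => (volume : Measure ℝ))

theorem measurableSet_openSimplex (n : ℕ) (t : ℝ) : MeasurableSet (openSimplex n t) := by
  unfold openSimplex
  measurability

theorem snoc_mem_openSimplex_iff {n : ℕ} {t x : ℝ} {s : Fin n → ℝ} :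
    (Fin.snoc s x : Fin (n + 1) → ℝ) ∈ openSimplex (n + 1) t ↔
      x ∈ Set.Ioo 0 t ∧ s ∈ openSimplex n x := by
  simp only [openSimplex, Set.mem_ofPred_eq, Fin.forall_fin_succ', Fin.snoc_castSucc,
    Fin.snoc_last, Fin.castSucc_lt_castSucc_iff, Fin.castSucc_lt_last, lt_irrefl, Set.mem_Ioo,
    forall_true_left, IsEmpty.forall_iff]
  constructor
  · rintro ⟨⟨h₁, -⟩, h₂, h₃⟩
    exact ⟨h₃, fun i j => (h₁ i).1 j, fun i => ⟨(h₂ i).1, (h₁ i).2⟩⟩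
  · rintro ⟨h₃, h₁, h₂⟩
    exact ⟨⟨fun i => ⟨h₁ i, (h₂ i).2⟩, fun i h => absurd h (Fin.castSucc_lt_last i).not_gt, trivial⟩,
      fun i => ⟨(h₂ i).1, (h₂ i).2.trans h₃.2⟩, h₃⟩

theorem chronoProd_snoc {𝔄 : Type*} [Monoid 𝔄] (H : ℝ → 𝔄) (n : ℕ) (s : Fin n → ℝ) (x : ℝ) :
    chronoProd H (n + 1) (Fin.snoc s x : Fin (n + 1) → ℝ) = H x * chronoProd H n s := by
  rw [chronoProd, List.ofFn_succ']
  simp [chronoProd, List.concat_eq_append]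

theorem continuous_chronoProd {𝔄 : Type*} [Monoid 𝔄] [TopologicalSpace 𝔄] [ContinuousMul 𝔄]
    {H : ℝ → 𝔄} (hH : Continuous H) (n : ℕ) : Continuous (chronoProd H n) := by
  induction n with
  | zero => exact continuous_of_const fun s s' => by simp [chronoProd]
  | succ n ih =>
    have h : chronoProd H (n + 1) =
        fun s => H (s (Fin.last n)) * chronoProd H n (Fin.init s) := by
      funext s
      rw [← chronoProd_snoc, Fin.snoc_init_self]
    rw [h]
    have : Continuous fun s : Fin (n + 1) → ℝ => (Fin.init s : Fin n → ℝ) :=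
      continuous_pi fun i => continuous_apply _
    exact (hH.comp (continuous_apply _)).mul (ih.comp this)

section

variable {𝔄 : Type*} [NormedRing 𝔄] [NormedAlgebra ℂ 𝔄]

/-- The iterated integrals `V₀ = 1`, `Vₙ₊₁(t) = ∫₀ᵗ H(s) Vₙ(s) ds`. -/
noncomputable def iteratedChronoIntegral (H : ℝ → 𝔄) : ℕ → ℝ → 𝔄
  | 0 => fun _ => 1
  | n + 1 => fun t => ∫ s in (0 : ℝ)..t, H s * iteratedChronoIntegral H n s

theorem hasDerivAt_iteratedChronoIntegral_succ_of_continuous [CompleteSpace 𝔄] {H : ℝ → 𝔄}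
    (hH : Continuous H) {n : ℕ} (hn : Continuous (iteratedChronoIntegral H n)) (t : ℝ) :
    HasDerivAt (iteratedChronoIntegral H (n + 1)) (H t * iteratedChronoIntegral H n t) t :=
  ((hH.mul hn).integral_hasStrictDerivAt 0 t).hasDerivAt

theorem continuous_iteratedChronoIntegral [CompleteSpace 𝔄] {H : ℝ → 𝔄} (hH : Continuous H)
    (n : ℕ) : Continuous (iteratedChronoIntegral H n) := by
  induction n with
  | zero => exact continuous_const
  | succ n ih =>
    exact continuous_iff_continuousAt.2 fun t =>
      (hasDerivAt_iteratedChronoIntegral_succ_of_continuous hH ih t).continuousAt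

theorem hasDerivAt_iteratedChronoIntegral_succ [CompleteSpace 𝔄] {H : ℝ → 𝔄}
    (hH : Continuous H) (n : ℕ) (t : ℝ) :
    HasDerivAt (iteratedChronoIntegral H (n + 1)) (H t * iteratedChronoIntegral H n t) t :=
  hasDerivAt_iteratedChronoIntegral_succ_of_continuous hH
    (continuous_iteratedChronoIntegral hH n) t

theorem norm_iteratedChronoIntegral_le {H : ℝ → 𝔄} {M : ℝ} (hM : ∀ s, ‖H s‖ ≤ M)
    (n : ℕ) (t : ℝ) :
    ‖iteratedChronoIntegral H n t‖ ≤ ‖(1 : 𝔄)‖ * ((M * |t|) ^ n / n.factorial) := by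
  have hM0 : 0 ≤ M := (norm_nonneg _).trans (hM 0)
  induction n generalizing t with
  | zero => simp [iteratedChronoIntegral]
  | succ n ih =>
    set C : ℝ := ‖(1 : 𝔄)‖ * M ^ (n + 1) / n.factorial with hC
    have hC0 : 0 ≤ C := by positivity
    have hbound : ∀ s, ‖H s * iteratedChronoIntegral H n s‖ ≤ C * |s - 0| ^ n := fun s =>
      calc ‖H s * iteratedChronoIntegral H n s‖
          ≤ ‖H s‖ * ‖iteratedChronoIntegral H n s‖ := norm_mul_le _ _
        _ ≤ M * (‖(1 : 𝔄)‖ * ((M * |s|) ^ n / n.factorial)) :=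
          mul_le_mul (hM s) (ih s) (norm_nonneg _) hM0
        _ = C * |s - 0| ^ n := by rw [hC, sub_zero]; ring
    have hint : IntervalIntegrable (fun s : ℝ => C * |s - 0| ^ n) volume 0 t :=
      Continuous.intervalIntegrable (by fun_prop) _ _
    calc ‖iteratedChronoIntegral H (n + 1) t‖
        ≤ |∫ s in (0 : ℝ)..t, C * |s - 0| ^ n| :=
          intervalIntegral.norm_integral_le_abs_of_norm_le
            (Filter.Eventually.of_forall hbound) hint
      _ = ∫ s in Set.uIoc 0 t, C * |s - 0| ^ n := by
          rw [intervalIntegral.abs_integral_eq_abs_integral_uIoc, abs_of_nonneg]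
          exact integral_nonneg fun s => by positivity
      _ = ‖(1 : 𝔄)‖ * ((M * |t|) ^ (n + 1) / (n + 1).factorial) := by
          rw [integral_const_mul, integral_pow_abs_sub_uIoc, hC, sub_zero, Nat.factorial_succ]
          push_cast
          rw [mul_pow]
          field_simp

theorem setIntegral_openSimplex_chronoProd [CompleteSpace 𝔄] {H : ℝ → 𝔄} (hH : Continuous H)
    (n : ℕ) {t : ℝ} (ht : 0 ≤ t) :
    ∫ s in openSimplex n t, chronoProd H n s ∂(Measure.pi fun _ : Fin n => (volume : Measure ℝ))
      = iteratedChronoIntegral H n t := by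
  induction n generalizing t with
  | zero =>
    have h : openSimplex 0 t = Set.univ := by ext s; simp [openSimplex]
    rw [h, Measure.pi_of_empty]
    simp [chronoProd, iteratedChronoIntegral]
  | succ n ih =>
    set e := MeasurableEquiv.piFinSuccAbove (fun _ : Fin (n + 1) => ℝ) (Fin.last n)
    have hsymm : ∀ p : ℝ × (Fin n → ℝ), e.symm p = (Fin.snoc p.2 p.1 : Fin (n + 1) → ℝ) :=
      fun p => Fin.insertNth_last' p.1 p.2
    set D : Set (ℝ × (Fin n → ℝ)) := e.symm ⁻¹' openSimplex (n + 1) t with hD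
    have hDm : MeasurableSet D := e.symm.measurable (measurableSet_openSimplex _ _)
    have hmem : ∀ p, p ∈ D ↔ p.1 ∈ Set.Ioo 0 t ∧ p.2 ∈ openSimplex n p.1 := fun p => by
      rw [hD, Set.mem_preimage, hsymm, snoc_mem_openSimplex_iff]
    have hpre : openSimplex (n + 1) t = e ⁻¹' D := by
      ext s; simp [hD]
    set g : ℝ × (Fin n → ℝ) → 𝔄 := fun p => H p.1 * chronoProd H n p.2 with hg
    have hgc : Continuous g :=
      (hH.comp continuous_fst).mul ((continuous_chronoProd hH n).comp continuous_snd)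
    have hge : ∀ s, chronoProd H (n + 1) s = g (e s) := fun s => by
      rw [hg, ← e.symm_apply_apply s, hsymm, chronoProd_snoc, ← hsymm, e.apply_symm_apply]
    have hint : IntegrableOn g D
        ((volume : Measure ℝ).prod (Measure.pi fun _ : Fin n => (volume : Measure ℝ))) := by
      refine (hgc.continuousOn.integrableOn_compact
        (isCompact_Icc (a := ((0 : ℝ), fun _ : Fin n => (0 : ℝ))) (b := (t, fun _ => t)))).mono_set
        fun p hp => ?_
      obtain ⟨⟨h₁, h₂⟩, h₃⟩ := (hmem p).1 hp
      exact ⟨⟨h₁.le, fun i => (h₃.2 i).1.le⟩, ⟨h₂.le, fun i => ((h₃.2 i).2.trans h₂).le⟩⟩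
    have hinner : ∀ x, ∫ y, D.indicator g (x, y) ∂(Measure.pi fun _ : Fin n => (volume : Measure ℝ))
        = (Set.Ioo 0 t).indicator (fun x => H x * iteratedChronoIntegral H n x) x := by
      intro x
      by_cases hx : x ∈ Set.Ioo 0 t
      · rw [Set.indicator_of_mem hx, ← ih hx.1.le, ← integral_indicator
          (measurableSet_openSimplex n x), ← integral_const_mul_of_integrable]
        · congr 1
          funext y
          by_cases hy : y ∈ openSimplex n x
          · rw [Set.indicator_of_mem ((hmem _).2 ⟨hx, hy⟩), Set.indicator_of_mem hy]
          · rw [Set.indicator_of_notMem fun h => hy ((hmem _).1 h).2,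
              Set.indicator_of_notMem hy, mul_zero]
        · rw [integrable_indicator_iff (measurableSet_openSimplex n x)]
          refine ((continuous_chronoProd hH n).continuousOn.integrableOn_compact
            (isCompact_Icc (a := fun _ : Fin n => (0 : ℝ)) (b := fun _ => x))).mono_set
            fun y hy => ?_
          exact ⟨fun i => (hy.2 i).1.le, fun i => (hy.2 i).2.le⟩
      · rw [Set.indicator_of_notMem hx]
        have : ∀ y, D.indicator g (x, y) = 0 := fun y =>
          Set.indicator_of_notMem (fun h => hx ((hmem _).1 h).1) _
        simp [this]
    have hmp := measurePreserving_piFinSuccAbove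
      (fun _ : Fin (n + 1) => (volume : Measure ℝ)) (Fin.last n)
    rw [hpre]
    simp_rw [hge]
    rw [hmp.setIntegral_preimage_emb e.measurableEmbedding, ← integral_indicator hDm,
      integral_prod _ ((integrable_indicator_iff hDm).2 hint)]
    simp_rw [hinner]
    rw [integral_indicator measurableSet_Ioo, ← integral_Ioc_eq_integral_Ioo,
      ← intervalIntegral.integral_of_le ht]
    rfl

/-- The time-ordered exponential as a series of iterated integrals; unlike `chronoExp`, it is
given by the same formula at negative times. -/
noncomputable def dysonSeries (H : ℝ → 𝔄) (t : ℝ) : 𝔄 :=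
  1 + ∑' n : ℕ, (-Complex.I) ^ (n + 1) • iteratedChronoIntegral H (n + 1) t

theorem chronoExp_eq_dysonSeries [CompleteSpace 𝔄] {H : ℝ → 𝔄} (hH : Continuous H) {t : ℝ}
    (ht : 0 ≤ t) : chronoExp H t = dysonSeries H t := by
  simp_rw [chronoExp, dysonSeries, setIntegral_openSimplex_chronoProd hH _ ht]

theorem chronoExp_congr [CompleteSpace 𝔄] {H K : ℝ → 𝔄} {t : ℝ}
    (h : ∀ s ∈ Set.Ioo 0 t, H s = K s) : chronoExp H t = chronoExp K t := by
  unfold chronoExp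
  congr 2
  funext n
  congr 1
  refine setIntegral_congr_fun (measurableSet_openSimplex _ _) fun s hs => ?_
  simp only [chronoProd]
  congr 3
  funext i
  exact h _ (hs.2 i)

@[simp]
theorem dysonSeries_zero (H : ℝ → 𝔄) : dysonSeries H 0 = 1 := by
  simp [dysonSeries, iteratedChronoIntegral]

theorem hasDerivAt_dysonSeries [CompleteSpace 𝔄] {H : ℝ → 𝔄} (hH : Continuous H) {M : ℝ}
    (hM : ∀ s, ‖H s‖ ≤ M) (t : ℝ) :
    HasDerivAt (dysonSeries H) (-Complex.I • (H t * dysonSeries H t)) t := by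
  have hM0 : 0 ≤ M := (norm_nonneg _).trans (hM 0)
  have hnorm : ∀ (n : ℕ) (x : 𝔄), ‖(-Complex.I) ^ n • x‖ = ‖x‖ := fun n x => by
    simp [norm_smul]
  have hsum : Summable fun n : ℕ => (-Complex.I) ^ n • iteratedChronoIntegral H n t :=
    .of_norm_bounded ((Real.summable_pow_div_factorial (M * |t|)).mul_left ‖(1 : 𝔄)‖)
      fun n => (hnorm _ _).trans_le (norm_iteratedChronoIntegral_le hM n t)
  have hseries : ∑' n : ℕ, (-Complex.I) ^ n • iteratedChronoIntegral H n t = dysonSeries H t := by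
    rw [hsum.tsum_eq_zero_add]
    simp [dysonSeries, iteratedChronoIntegral]
  have hderiv : ∀ (n : ℕ) (x : ℝ),
      HasDerivAt (fun x => (-Complex.I) ^ (n + 1) • iteratedChronoIntegral H (n + 1) x)
        ((-Complex.I) ^ (n + 1) • (H x * iteratedChronoIntegral H n x)) x := fun n x =>
    (hasDerivAt_iteratedChronoIntegral_succ hH n x).fun_const_smul ((-Complex.I) ^ (n + 1))
  set R : ℝ := |t| + 1
  have hmem : ∀ {x : ℝ}, x ∈ Metric.ball (0 : ℝ) R ↔ |x| < R := by simp
  have hbound : ∀ (n : ℕ), ∀ x ∈ Metric.ball (0 : ℝ) R,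
      ‖(-Complex.I) ^ (n + 1) • (H x * iteratedChronoIntegral H n x)‖ ≤
        M * (‖(1 : 𝔄)‖ * ((M * R) ^ n / n.factorial)) := fun n x hx => by
    have := (hmem.1 hx).le
    calc ‖(-Complex.I) ^ (n + 1) • (H x * iteratedChronoIntegral H n x)‖
        ≤ ‖H x‖ * ‖iteratedChronoIntegral H n x‖ := (hnorm _ _).trans_le (norm_mul_le _ _)
      _ ≤ M * (‖(1 : 𝔄)‖ * ((M * |x|) ^ n / n.factorial)) :=
        mul_le_mul (hM x) (norm_iteratedChronoIntegral_le hM n x) (norm_nonneg _) hM0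
      _ ≤ M * (‖(1 : 𝔄)‖ * ((M * R) ^ n / n.factorial)) := by gcongr
  have hmajorant : Summable fun n : ℕ => M * (‖(1 : 𝔄)‖ * ((M * R) ^ n / n.factorial)) :=
    ((Real.summable_pow_div_factorial (M * R)).mul_left _).mul_left _
  have ht : t ∈ Metric.ball (0 : ℝ) R := hmem.2 (lt_add_one _)
  have hsum' : Summable fun n : ℕ =>
      (-Complex.I) ^ (n + 1) • iteratedChronoIntegral H (n + 1) t :=
    hsum.comp_injective (add_left_injective 1)
  have key := hasDerivAt_tsum_of_isPreconnected hmajorant Metric.isOpen_ball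
    (convex_ball _ _).isPreconnected (fun n x _ => hderiv n x) hbound ht hsum' ht
  have key' : HasDerivAt (dysonSeries H)
      (∑' n : ℕ, (-Complex.I) ^ (n + 1) • (H t * iteratedChronoIntegral H n t)) t :=
    key.const_add 1
  refine key'.congr_deriv ?_
  rw [← hseries, ← hsum.tsum_mul_left, ← (hsum.mul_left (H t)).tsum_const_smul]
  congr 1
  funext n
  rw [pow_succ', mul_smul, mul_smul_comm]

end

section

variable {𝔄 : Type*} [NormedRing 𝔄] [StarRing 𝔄] [CStarRing 𝔄] [NormedAlgebra ℂ 𝔄]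
  [CompleteSpace 𝔄] [StarModule ℂ 𝔄] {H : ℝ → 𝔄} {M : ℝ}

theorem hasDerivAt_star_dysonSeries (hH : Continuous H) (hM : ∀ s, ‖H s‖ ≤ M)
    (hherm : ∀ s, star (H s) = H s) (t : ℝ) :
    HasDerivAt (fun t => star (dysonSeries H t))
      (Complex.I • (star (dysonSeries H t) * H t)) t :=
  (hasDerivAt_dysonSeries hH hM t).star.congr_deriv (by simp [star_smul, hherm])

theorem star_dysonSeries_mul_self (hH : Continuous H) (hM : ∀ s, ‖H s‖ ≤ M)
    (hherm : ∀ s, star (H s) = H s) (t : ℝ) :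
    star (dysonSeries H t) * dysonSeries H t = 1 := by
  have hd : ∀ t, HasDerivAt (fun t => star (dysonSeries H t) * dysonSeries H t) 0 t := fun t =>
    ((hasDerivAt_star_dysonSeries hH hM hherm t).mul (hasDerivAt_dysonSeries hH hM t)).congr_deriv
      (by simp [mul_assoc])
  simpa using is_const_of_deriv_eq_zero (fun t => (hd t).differentiableAt)
    (fun t => (hd t).deriv) t 0

theorem dysonSeries_mul_star_self (hH : Continuous H) (hM : ∀ s, ‖H s‖ ≤ M)
    (hherm : ∀ s, star (H s) = H s) (t : ℝ) :
    dysonSeries H t * star (dysonSeries H t) = 1 := by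
  have hd : ∀ t, HasDerivAt (fun t => dysonSeries H t * star (dysonSeries H t))
      (-Complex.I • (H t * (dysonSeries H t * star (dysonSeries H t)) -
        dysonSeries H t * star (dysonSeries H t) * H t)) t := fun t =>
    ((hasDerivAt_dysonSeries hH hM t).mul (hasDerivAt_star_dysonSeries hH hM hherm t)).congr_deriv
      (by simp [mul_assoc, smul_sub])
  have hlip : ∀ t, LipschitzOnWith (2 * M).toNNReal
      (fun x : 𝔄 => -Complex.I • (H t * x - x * H t)) Set.univ := fun t =>
    LipschitzOnWith.of_dist_le' fun x _ y _ => by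
      rw [dist_eq_norm, dist_eq_norm, ← smul_sub, norm_smul, norm_neg, Complex.norm_I, one_mul,
        show H t * x - x * H t - (H t * y - y * H t) = H t * (x - y) - (x - y) * H t by
          noncomm_ring]
      calc ‖H t * (x - y) - (x - y) * H t‖ ≤ ‖H t‖ * ‖x - y‖ + ‖x - y‖ * ‖H t‖ :=
            (norm_sub_le _ _).trans (add_le_add (norm_mul_le _ _) (norm_mul_le _ _))
        _ = 2 * ‖H t‖ * ‖x - y‖ := by ring
        _ ≤ 2 * M * ‖x - y‖ := by gcongr; exact hM t
  have h := ODE_solution_unique_univ (t₀ := 0) hlip (fun t => ⟨hd t, Set.mem_univ _⟩)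
    (g := fun _ => 1) (fun t => ⟨by simpa using hasDerivAt_const t (1 : 𝔄), Set.mem_univ _⟩)
    (by simp)
  exact congrFun h t

end

/-- Unitarity of the time-ordered exponential: if `H` is continuous and Hermitian
on `[0, T]`, then `U(t)` is unitary for every `t ∈ [0, T]`. -/
theorem chronoExp_unitary {𝔄 : Type*} [NormedRing 𝔄] [StarRing 𝔄] [CStarRing 𝔄]
    [NormedAlgebra ℂ 𝔄] [CompleteSpace 𝔄] [StarModule ℂ 𝔄]
    (H : ℝ → 𝔄) (hH : Continuous H) (T : ℝ)
    (hherm : ∀ s ∈ Set.Icc (0 : ℝ) T, star (H s) = H s) :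
    ∀ t ∈ Set.Icc (0 : ℝ) T,
      star (chronoExp H t) * chronoExp H t = 1 ∧
        chronoExp H t * star (chronoExp H t) = 1 := by
  intro t ht
  have hT : 0 ≤ T := ht.1.trans ht.2
  set K : ℝ → 𝔄 := fun s => H (Set.projIcc 0 T hT s) with hK
  have hKc : Continuous K := hH.comp (continuous_subtype_val.comp continuous_projIcc)
  have hKherm : ∀ s, star (K s) = K s := fun s => hherm _ (Set.projIcc 0 T hT s).2
  obtain ⟨M, hM⟩ := isCompact_Icc.exists_bound_of_continuousOn hH.continuousOn
  have hKM : ∀ s, ‖K s‖ ≤ M := fun s => hM _ (Set.projIcc 0 T hT s).2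
  have hHK : chronoExp H t = dysonSeries K t := by
    rw [← chronoExp_eq_dysonSeries hKc ht.1]
    refine chronoExp_congr fun s hs => ?_
    simp only [hK]
    rw [Set.projIcc_of_mem hT ⟨hs.1.le, hs.2.le.trans ht.2⟩]
  rw [hHK]
  exact ⟨star_dysonSeries_mul_self hKc hKM hKherm t, dysonSeries_mul_star_self hKc hKM hKherm t⟩
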